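/- In the avg-AL reduction instance built from a simple graph H = (V, E) and an integer k ≥ 3 with |V| + |E| > k and k+1 divisible by 3, under avg-AL utilities with fixed weight w ≥ n^4, the following holds: if a coalition C blocks the coalition structure Γ and the vertex player x' belongs to C for some x ∈ V, then every friend of x' in C has exactly three friends in C, and the number of edges e ∈ E incident to x whose edge player e' belongs to C is at least k−1. -/

import Mathlib

open Finset
open scoped Classical

section AHGDefs

variable {N : Type*} [Fintype N] [DecidableEq N]

/-- The set of friends of player `i` inside coalition `C`. -/
noncomputable def friendsIn (G : SimpleGraph N) (C : Finset N) (i : N) : Finset N :=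
  C.filter fun j => G.Adj i j

/-- The friend-oriented valuation of coalition `C` by player `i`:
`val_i(C) = n·|F_i ∩ C| − |E_i ∩ C|`. -/
noncomputable def fval (G : SimpleGraph N) (C : Finset N) (i : N) : ℤ :=
  (Fintype.card N : ℤ) * ((friendsIn G C i).card : ℤ)
    - ((C.filter fun j => ¬ G.Adj i j ∧ j ≠ i).card : ℤ)

/-- Average-based equal-treatment utility. -/
noncomputable def utilAvgEQ (G : SimpleGraph N) (C : Finset N) (i : N) : ℚ :=
  (∑ c ∈ insert i (friendsIn G C i), (fval G C c : ℚ)) /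
    ((insert i (friendsIn G C i)).card : ℚ)

/-- Average-based altruistic-treatment utility with weight `w`. -/
noncomputable def utilAvgAL (G : SimpleGraph N) (w : ℚ) (C : Finset N) (i : N) : ℚ :=
  (fval G C i : ℚ) +
    w * (if (friendsIn G C i).Nonempty then
          (∑ c ∈ friendsIn G C i, (fval G C c : ℚ)) / ((friendsIn G C i).card : ℚ)
         else 0)

/-- Min-based equal-treatment utility. -/
noncomputable def utilMinEQ (G : SimpleGraph N) (C : Finset N) (i : N) : ℤ :=
  (insert i (friendsIn G C i)).inf' (insert_nonempty _ _) (fval G C)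

/-- Min-based altruistic-treatment utility with weight `w`. -/
noncomputable def utilMinAL (G : SimpleGraph N) (w : ℤ) (C : Finset N) (i : N) : ℤ :=
  fval G C i +
    w * (if h : (friendsIn G C i).Nonempty then (friendsIn G C i).inf' h (fval G C) else 0)

/-- A coalition structure (partition of the players), given as the map sending
each player to its coalition. -/
structure CoalitionStructure (N : Type*) [Fintype N] [DecidableEq N] where
  part : N → Finset N
  mem_part : ∀ i, i ∈ part i
  part_eq : ∀ i j, j ∈ part i → part j = part i

/-- A (nonempty) coalition `C` blocks the coalition structure `Γ`. -/
def Blocks {α : Type*} [LT α] (util : Finset N → N → α) (Γ : CoalitionStructure N)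
    (C : Finset N) : Prop :=
  C.Nonempty ∧ ∀ i ∈ C, util (Γ.part i) i < util C i

/-- Core stability: no nonempty coalition blocks `Γ`. -/
def CoreStable {α : Type*} [LT α] (util : Finset N → N → α)
    (Γ : CoalitionStructure N) : Prop :=
  ¬ ∃ C : Finset N, Blocks util Γ C

/-- The base clique of a pinched `(d,k')`-dome gadget on `P` with top player `top`
and (unique) mid player `mid`. -/
noncomputable def pdomeBase (P : Finset N) (top mid : N) : Finset N :=
  P \ {top, mid}

/-- `P` carries a pinched `(d,k')`-dome gadget of the graph `G`, with top player `top`,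
the unique mid player `mid` (obtained by identifying the `d` mid players) and fringe
players `fringe i`. -/
structure IsPinchedDomeGadget (G : SimpleGraph N) (d k' : ℕ) (P : Finset N) (top mid : N)
    (fringe : Fin d → N) : Prop where
  card_eq : P.card = k' - d + 1
  top_mem : top ∈ P
  mid_mem : mid ∈ P
  mid_ne_top : mid ≠ top
  fringe_mem : ∀ i, fringe i ∈ pdomeBase P top mid
  fringe_inj : Function.Injective fringe
  adj_iff : ∀ x ∈ P, ∀ y ∈ P, (G.Adj x y ↔
    ((x = top ∧ y = mid) ∨ (y = top ∧ x = mid) ∨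
     (x ∈ pdomeBase P top mid ∧ y ∈ pdomeBase P top mid ∧ x ≠ y) ∨
     (x = mid ∧ ∃ i, y = fringe i) ∨ (y = mid ∧ ∃ i, x = fringe i)))

/-- `P` carries a pinched `(d,k')`-dome gadget with top player `top`. -/
def HasPinchedDomeGadget (G : SimpleGraph N) (d k' : ℕ) (P : Finset N) (top : N) : Prop :=
  ∃ (mid : N) (fringe : Fin d → N), IsPinchedDomeGadget G d k' P top mid fringe

/-- The gadget size `k' = k + 3·(k choose 2) + 1` of the average-based reductions. -/
def avgK' (k : ℕ) : ℕ := k + 3 * Nat.choose k 2 + 1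

variable {V : Type*} [Fintype V] [DecidableEq V]

/-- `Γ` is the coalition structure of the average-based reduction instances: its
coalitions are exactly the gadget player sets. -/
def IsAvgGamma (H : SimpleGraph V) (Pv : V → Finset N) (Pe : Sym2 V → Finset N)
    (Pve : V → Sym2 V → Finset N) (Γ : CoalitionStructure N) : Prop :=
  (∀ v : V, ∀ i ∈ Pv v, Γ.part i = Pv v) ∧
  (∀ e ∈ H.edgeSet, ∀ i ∈ Pe e, Γ.part i = Pe e) ∧
  (∀ (v : V), ∀ e ∈ H.edgeSet, v ∈ e → ∀ i ∈ Pve v e, Γ.part i = Pve v e)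

/-- The avg-AL reduction instance built from the graph `H` and `k ≥ 3` with `3 ∣ k+1`:
`G` is the constructed network of friends; `Pv v` and `Pe e` carry pinched
`(2,k')`-dome gadgets with top players `vp v` and `ep e`, and `Pve v e` a pinched
`((k+1)/3,k')`-dome gadget with top player `bp v e`. For each edge `e = xy` of `H`,
the player `bp x e` is further adjacent to `vp x`, to `ep e`, and to `bp y e`,
and there are no other edges. -/
structure AvgALReduction (H : SimpleGraph V) (k : ℕ) (G : SimpleGraph N)
    (Pv : V → Finset N) (Pe : Sym2 V → Finset N) (Pve : V → Sym2 V → Finset N)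
    (vp : V → N) (ep : Sym2 V → N) (bp : V → Sym2 V → N) : Prop where
  pdome_v : ∀ v : V, HasPinchedDomeGadget G 2 (avgK' k) (Pv v) (vp v)
  pdome_e : ∀ e ∈ H.edgeSet, HasPinchedDomeGadget G 2 (avgK' k) (Pe e) (ep e)
  pdome_ve : ∀ (v : V), ∀ e ∈ H.edgeSet, v ∈ e →
    HasPinchedDomeGadget G ((k + 1) / 3) (avgK' k) (Pve v e) (bp v e)
  disj_vv : ∀ v w : V, v ≠ w → Disjoint (Pv v) (Pv w)
  disj_ee : ∀ e ∈ H.edgeSet, ∀ f ∈ H.edgeSet, e ≠ f → Disjoint (Pe e) (Pe f)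
  disj_bb : ∀ (v : V), ∀ e ∈ H.edgeSet, v ∈ e → ∀ (w : V), ∀ f ∈ H.edgeSet, w ∈ f →
    (v, e) ≠ (w, f) → Disjoint (Pve v e) (Pve w f)
  disj_v_e : ∀ (v : V), ∀ e ∈ H.edgeSet, Disjoint (Pv v) (Pe e)
  disj_v_b : ∀ (v w : V), ∀ f ∈ H.edgeSet, w ∈ f → Disjoint (Pv v) (Pve w f)
  disj_e_b : ∀ e ∈ H.edgeSet, ∀ (w : V), ∀ f ∈ H.edgeSet, w ∈ f →
    Disjoint (Pe e) (Pve w f)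
  cover : ∀ x : N, (∃ v : V, x ∈ Pv v) ∨ (∃ e ∈ H.edgeSet, x ∈ Pe e) ∨
    (∃ (v : V), ∃ e ∈ H.edgeSet, v ∈ e ∧ x ∈ Pve v e)
  adj_bv : ∀ (v : V), ∀ e ∈ H.edgeSet, v ∈ e → G.Adj (bp v e) (vp v)
  adj_be : ∀ (v : V), ∀ e ∈ H.edgeSet, v ∈ e → G.Adj (bp v e) (ep e)
  adj_bb : ∀ x y : V, H.Adj x y → G.Adj (bp x s(x, y)) (bp y s(x, y))
  adj_cases : ∀ x y : N, G.Adj x y →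
    (∃ v : V, x ∈ Pv v ∧ y ∈ Pv v) ∨
    (∃ e ∈ H.edgeSet, x ∈ Pe e ∧ y ∈ Pe e) ∨
    (∃ (v : V), ∃ e ∈ H.edgeSet, v ∈ e ∧ x ∈ Pve v e ∧ y ∈ Pve v e) ∨
    (∃ (v : V), ∃ e ∈ H.edgeSet, v ∈ e ∧
      ((x = bp v e ∧ y = vp v) ∨ (y = bp v e ∧ x = vp v))) ∨
    (∃ (v : V), ∃ e ∈ H.edgeSet, v ∈ e ∧
      ((x = bp v e ∧ y = ep e) ∨ (y = bp v e ∧ x = ep e))) ∨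
    (∃ a b : V, H.Adj a b ∧
      ((x = bp a s(a, b) ∧ y = bp b s(a, b)) ∨ (y = bp a s(a, b) ∧ x = bp b s(a, b))))
end AHGDefs

section AvgAL

variable {N : Type*} {G : SimpleGraph N} {A C : Finset N} {i j : N}

lemma mem_friendsIn : j ∈ friendsIn G C i ↔ j ∈ C ∧ G.Adj i j := by
  simp [friendsIn]

lemma friendsIn_subset_of_closed {top : N} (hcl : ∀ i ∈ A, i ≠ top → ∀ j, G.Adj i j → j ∈ A)
    (hi : i ∈ A) (hne : i ≠ top) : friendsIn G C i ⊆ friendsIn G A i := by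
  intro j hj
  rw [mem_friendsIn] at hj ⊢
  exact ⟨hcl i hi hne j hj.2, hj.2⟩

lemma friendsIn_eq_of_subset (h : A ⊆ C) (hcl : ∀ j, G.Adj i j → j ∈ A) :
    friendsIn G C i = friendsIn G A i := by
  ext j
  simp only [mem_friendsIn]
  exact ⟨fun hj => ⟨hcl j hj.2, hj.2⟩, fun hj => ⟨h hj.1, hj.2⟩⟩

/-- The sum over the friends `c` of `i` in `C` of the number of friends of `c` in `C`. -/
noncomputable def friendDegSum (G : SimpleGraph N) (C : Finset N) (i : N) : ℕ :=
  ∑ c ∈ friendsIn G C i, (friendsIn G C c).card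

lemma card_friendsIn_le_friendDegSum (hi : i ∈ C) :
    (friendsIn G C i).card ≤ friendDegSum G C i := by
  rw [card_eq_sum_ones]
  refine sum_le_sum fun c hc => ?_
  exact card_pos.2 ⟨i, mem_friendsIn.2 ⟨hi, (mem_friendsIn.1 hc).2.symm⟩⟩

variable [DecidableEq N]

lemma card_friends_add_enemies (hi : i ∈ C) :
    (friendsIn G C i).card + (C.filter fun j => ¬ G.Adj i j ∧ j ≠ i).card + 1 = C.card := by
  have h1 : friendsIn G C i = (C.erase i).filter (fun j => G.Adj i j) := by
    ext j
    simp only [mem_friendsIn, mem_filter, mem_erase]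
    exact ⟨fun h => ⟨⟨h.2.ne', h.1⟩, h.2⟩, fun h => ⟨h.1.2, h.2⟩⟩
  have h2 : (C.filter fun j => ¬ G.Adj i j ∧ j ≠ i)
      = (C.erase i).filter (fun j => ¬ G.Adj i j) := by
    ext j
    simp only [mem_filter, mem_erase]
    tauto
  rw [h1, h2, card_filter_add_card_filter_not, card_erase_add_one hi]

variable {d K : ℕ} {P : Finset N} {top mid : N} {fringe : Fin d → N}

lemma top_notMem_pdomeBase : top ∉ pdomeBase P top mid := by simp [pdomeBase]

lemma mid_notMem_pdomeBase : mid ∉ pdomeBase P top mid := by simp [pdomeBase]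

namespace IsPinchedDomeGadget

variable (hP : IsPinchedDomeGadget G d K P top mid fringe)
include hP

lemma mem_iff : i ∈ P ↔ i = top ∨ i = mid ∨ i ∈ pdomeBase P top mid := by
  have h1 := hP.top_mem
  have h2 := hP.mid_mem
  simp only [pdomeBase, mem_sdiff, mem_insert, mem_singleton]
  grind

lemma card_base_add_two : (pdomeBase P top mid).card + 2 = P.card := by
  have h : ({top, mid} : Finset N) ⊆ P := by
    intro j hj
    simp only [mem_insert, mem_singleton] at hj
    rcases hj with rfl | rfl
    exacts [hP.top_mem, hP.mid_mem]
  rw [pdomeBase, ← card_sdiff_add_card_eq_card h, card_pair hP.mid_ne_top.symm]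

lemma card_image_fringe : (univ.image fringe).card = d := by
  rw [card_image_of_injective _ hP.fringe_inj, card_univ, Fintype.card_fin]

lemma image_fringe_subset : univ.image fringe ⊆ pdomeBase P top mid := by
  intro j hj
  obtain ⟨a, -, rfl⟩ := mem_image.1 hj
  exact hP.fringe_mem a

lemma friendsIn_top : friendsIn G P top = {mid} := by
  have h1 := top_notMem_pdomeBase (P := P) (top := top) (mid := mid)
  have h2 := hP.mid_ne_top
  ext j
  rw [mem_friendsIn, mem_singleton]
  constructor
  · rintro ⟨hj, h⟩
    rw [hP.adj_iff _ hP.top_mem _ hj] at h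
    have h3 := hP.fringe_mem
    grind
  · rintro rfl
    exact ⟨hP.mid_mem, (hP.adj_iff _ hP.top_mem _ hP.mid_mem).2 (Or.inl ⟨rfl, rfl⟩)⟩

lemma friendsIn_mid : friendsIn G P mid = insert top (univ.image fringe) := by
  have h1 := mid_notMem_pdomeBase (P := P) (top := top) (mid := mid)
  have h2 := hP.mid_ne_top
  have h3 := hP.fringe_mem
  ext j
  simp only [mem_friendsIn, mem_insert, mem_image, mem_univ, true_and]
  constructor
  · rintro ⟨hj, h⟩
    rw [hP.adj_iff _ hP.mid_mem _ hj] at h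
    grind
  · rintro (rfl | ⟨a, rfl⟩)
    · exact ⟨hP.top_mem, (hP.adj_iff _ hP.mid_mem _ hP.top_mem).2 (Or.inr (Or.inl ⟨rfl, rfl⟩))⟩
    · have h4 : fringe a ∈ P := hP.mem_iff.2 (Or.inr (Or.inr (h3 a)))
      exact ⟨h4, (hP.adj_iff _ hP.mid_mem _ h4).2
        (Or.inr (Or.inr (Or.inr (Or.inl ⟨rfl, a, rfl⟩))))⟩

lemma friendsIn_base_of_notMem_fringe (hi : i ∈ pdomeBase P top mid)
    (hf : i ∉ univ.image fringe) :
    friendsIn G P i = (pdomeBase P top mid).erase i := by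
  have h0 := top_notMem_pdomeBase (P := P) (top := top) (mid := mid)
  have h1 := mid_notMem_pdomeBase (P := P) (top := top) (mid := mid)
  have hiP : i ∈ P := hP.mem_iff.2 (Or.inr (Or.inr hi))
  simp only [mem_image, mem_univ, true_and, not_exists] at hf
  ext j
  simp only [mem_friendsIn, mem_erase]
  constructor
  · rintro ⟨hj, h⟩
    rw [hP.adj_iff _ hiP _ hj] at h
    grind
  · rintro ⟨hj, h⟩
    have hjP : j ∈ P := hP.mem_iff.2 (Or.inr (Or.inr h))
    exact ⟨hjP, (hP.adj_iff _ hiP _ hjP).2 (Or.inr (Or.inr (Or.inl ⟨hi, h, hj.symm⟩)))⟩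

lemma friendsIn_fringe (hf : i ∈ univ.image fringe) :
    friendsIn G P i = insert mid ((pdomeBase P top mid).erase i) := by
  have h0 := top_notMem_pdomeBase (P := P) (top := top) (mid := mid)
  have h1 := mid_notMem_pdomeBase (P := P) (top := top) (mid := mid)
  have hi := hP.image_fringe_subset hf
  have hiP : i ∈ P := hP.mem_iff.2 (Or.inr (Or.inr hi))
  simp only [mem_image, mem_univ, true_and] at hf
  ext j
  simp only [mem_friendsIn, mem_insert, mem_erase]
  constructor
  · rintro ⟨hj, h⟩
    rw [hP.adj_iff _ hiP _ hj] at h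
    grind
  · rintro (rfl | ⟨hj, h⟩)
    · obtain ⟨a, rfl⟩ := hf
      exact ⟨hP.mid_mem, (hP.adj_iff _ hiP _ hP.mid_mem).2
        (Or.inr (Or.inr (Or.inr (Or.inr ⟨rfl, a, rfl⟩))))⟩
    · have hjP : j ∈ P := hP.mem_iff.2 (Or.inr (Or.inr h))
      exact ⟨hjP, (hP.adj_iff _ hiP _ hjP).2 (Or.inr (Or.inr (Or.inl ⟨hi, h, hj.symm⟩)))⟩

lemma card_friendsIn_mid : (friendsIn G P mid).card = d + 1 := by
  rw [hP.friendsIn_mid, card_insert_of_notMem, hP.card_image_fringe]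
  exact fun h => top_notMem_pdomeBase (hP.image_fringe_subset h)

lemma card_friendsIn_fringe (hf : i ∈ univ.image fringe) :
    (friendsIn G P i).card = (pdomeBase P top mid).card := by
  rw [hP.friendsIn_fringe hf, card_insert_of_notMem, card_erase_add_one]
  · exact hP.image_fringe_subset hf
  · exact fun h => mid_notMem_pdomeBase (mem_of_mem_erase h)

lemma card_friendsIn_base_of_notMem_fringe (hi : i ∈ pdomeBase P top mid)
    (hf : i ∉ univ.image fringe) :
    (friendsIn G P i).card = (pdomeBase P top mid).card - 1 := by
  rw [hP.friendsIn_base_of_notMem_fringe hi hf, card_erase_of_mem hi]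

lemma card_friendsIn_base (hi : i ∈ pdomeBase P top mid) :
    (friendsIn G P i).card =
      (pdomeBase P top mid).card - 1 + if i ∈ univ.image fringe then 1 else 0 := by
  have := card_pos.2 ⟨i, hi⟩
  split_ifs with hf
  · rw [hP.card_friendsIn_fringe hf]
    omega
  · rw [hP.card_friendsIn_base_of_notMem_fringe hi hf, add_zero]

lemma friendDegSum_top : friendDegSum G P top = d + 1 := by
  rw [friendDegSum, hP.friendsIn_top, sum_singleton, hP.card_friendsIn_mid]

lemma mul_card_base_le_friendDegSum_mid :
    d * (pdomeBase P top mid).card ≤ friendDegSum G P mid := by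
  rw [friendDegSum, hP.friendsIn_mid, sum_insert
    fun h => top_notMem_pdomeBase (hP.image_fringe_subset h),
    sum_congr rfl fun c hc => hP.card_friendsIn_fringe hc, sum_const, hP.card_image_fringe,
    smul_eq_mul]
  omega

lemma friendDegSum_base_of_notMem_fringe (hi : i ∈ pdomeBase P top mid)
    (hf : i ∉ univ.image fringe) :
    friendDegSum G P i = ((pdomeBase P top mid).card - 1) ^ 2 + d := by
  have h : (pdomeBase P top mid).erase i ∩ univ.image fringe = univ.image fringe :=
    inter_eq_right.2 fun j hj =>
      mem_erase.2 ⟨fun h => hf (h ▸ hj), hP.image_fringe_subset hj⟩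
  rw [friendDegSum, hP.friendsIn_base_of_notMem_fringe hi hf,
    sum_congr rfl fun c hc => hP.card_friendsIn_base (mem_of_mem_erase hc), sum_add_distrib,
    sum_const, card_erase_of_mem hi, sum_ite_mem, h, sum_const, hP.card_image_fringe]
  simp [sq]

lemma le_friendDegSum_fringe (hf : i ∈ univ.image fringe) :
    ((pdomeBase P top mid).card - 1) ^ 2 ≤ friendDegSum G P i := by
  have hi := hP.image_fringe_subset hf
  rw [friendDegSum, hP.friendsIn_fringe hf, sum_insert
    fun h => mid_notMem_pdomeBase (mem_of_mem_erase h),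
    sum_congr rfl fun c hc => hP.card_friendsIn_base (mem_of_mem_erase hc), sum_add_distrib,
    sum_const, card_erase_of_mem hi, smul_eq_mul, sq]
  omega

end IsPinchedDomeGadget

lemma sub_one_le_of_mul_le {n F k K : ℤ} (hK : 0 ≤ K) (hk : 5 ≤ k) (hF : 1 ≤ F)
    (hn : (F + 1) * (K + 1) ≤ n) (h : (n + 1) * (k - 1 - F) ≤ 3 * (K + 1)) : k - 1 ≤ F := by
  by_contra! hlt
  rcases (show F + 2 ≤ k by omega).eq_or_lt with rfl | h2
  · have := mul_le_mul_of_nonneg_right (show 3 ≤ F by linarith) (show 0 ≤ K + 1 by linarith)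
    linarith
  · have h3 := mul_le_mul_of_nonneg_right hF (show 0 ≤ K + 1 by linarith)
    have := mul_le_mul_of_nonneg_left (show 2 ≤ k - 1 - F by omega)
      (show 0 ≤ n + 1 by linarith)
    linarith

lemma seven_mul_add_one_le_avgK' {k : ℕ} (hk : 5 ≤ k) : 7 * k + 1 ≤ avgK' k := by
  have h : 2 * k ≤ Nat.choose k 2 := by
    rw [Nat.choose_two_right, Nat.le_div_iff_mul_le two_pos, mul_comm 2, mul_assoc]
    exact Nat.mul_le_mul_left k (by omega)
  unfold avgK'
  omega

namespace AvgALReduction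

variable {V : Type*} {H : SimpleGraph V} {k : ℕ}
  {Pv : V → Finset N} {Pe : Sym2 V → Finset N} {Pve : V → Sym2 V → Finset N}
  {vp : V → N} {ep : Sym2 V → N} {bp : V → Sym2 V → N} {v : V} {e : Sym2 V}
  (R : AvgALReduction H k G Pv Pe Pve vp ep bp)
include R

lemma vp_mem (v : V) : vp v ∈ Pv v := by
  obtain ⟨_, _, h⟩ := R.pdome_v v
  exact h.top_mem

lemma ep_mem (he : e ∈ H.edgeSet) : ep e ∈ Pe e := by
  obtain ⟨_, _, h⟩ := R.pdome_e e he
  exact h.top_mem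

lemma bp_mem (he : e ∈ H.edgeSet) (hv : v ∈ e) : bp v e ∈ Pve v e := by
  obtain ⟨_, _, h⟩ := R.pdome_ve v e he hv
  exact h.top_mem

lemma eq_of_mem_Pv {u : V} (hv : i ∈ Pv v) (hu : i ∈ Pv u) : v = u := by
  by_contra h
  exact disjoint_left.1 (R.disj_vv v u h) hv hu

lemma eq_of_mem_Pe {f : Sym2 V} (he : e ∈ H.edgeSet) (hf : f ∈ H.edgeSet) (hie : i ∈ Pe e)
    (hif : i ∈ Pe f) : e = f := by
  by_contra h
  exact disjoint_left.1 (R.disj_ee e he f hf h) hie hif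

lemma eq_of_mem_Pve {u : V} {f : Sym2 V} (he : e ∈ H.edgeSet) (hv : v ∈ e)
    (hf : f ∈ H.edgeSet) (hu : u ∈ f) (hie : i ∈ Pve v e) (hif : i ∈ Pve u f) :
    v = u ∧ e = f := by
  by_contra h
  refine disjoint_left.1 (R.disj_bb v e he hv u f hf hu fun h' => h ?_) hie hif
  simpa using h'

lemma notMem_Pe_of_mem_Pv (hv : i ∈ Pv v) (he : e ∈ H.edgeSet) : i ∉ Pe e :=
  disjoint_left.1 (R.disj_v_e v e he) hv

lemma notMem_Pve_of_mem_Pv {u : V} (hv : i ∈ Pv v) (he : e ∈ H.edgeSet) (hu : u ∈ e) :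
    i ∉ Pve u e :=
  disjoint_left.1 (R.disj_v_b v u e he hu) hv

lemma notMem_Pve_of_mem_Pe {f : Sym2 V} (hie : i ∈ Pe e) (he : e ∈ H.edgeSet)
    (hf : f ∈ H.edgeSet) (hv : v ∈ f) : i ∉ Pve v f :=
  disjoint_left.1 (R.disj_e_b e he v f hf hv) hie

lemma adj_of_mem_Pv (hi : i ∈ Pv v) (h : G.Adj i j) :
    j ∈ Pv v ∨ i = vp v ∧ ∃ e ∈ H.edgeSet, v ∈ e ∧ j = bp v e := by
  rcases R.adj_cases i j h with ⟨u, hiu, hju⟩ | ⟨e, he, hie, -⟩ | ⟨u, e, he, hu, hie, -⟩ |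
    ⟨u, e, he, hu, ⟨rfl, rfl⟩ | ⟨rfl, rfl⟩⟩ | ⟨u, e, he, hu, ⟨rfl, rfl⟩ | ⟨rfl, rfl⟩⟩ |
    ⟨a, b, hab, ⟨rfl, rfl⟩ | ⟨rfl, rfl⟩⟩
  · exact Or.inl (R.eq_of_mem_Pv hi hiu ▸ hju)
  · exact (R.notMem_Pe_of_mem_Pv hi he hie).elim
  · exact (R.notMem_Pve_of_mem_Pv hi he hu hie).elim
  · exact (R.notMem_Pve_of_mem_Pv hi he hu (R.bp_mem he hu)).elim
  · obtain rfl := R.eq_of_mem_Pv hi (R.vp_mem u)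
    exact Or.inr ⟨rfl, e, he, hu, rfl⟩
  · exact (R.notMem_Pve_of_mem_Pv hi he hu (R.bp_mem he hu)).elim
  · exact (R.notMem_Pe_of_mem_Pv hi he (R.ep_mem he)).elim
  · exact (R.notMem_Pve_of_mem_Pv hi hab (Sym2.mem_mk_left a b)
      (R.bp_mem hab (Sym2.mem_mk_left a b))).elim
  · exact (R.notMem_Pve_of_mem_Pv hi hab (Sym2.mem_mk_right a b)
      (R.bp_mem hab (Sym2.mem_mk_right a b))).elim

lemma adj_of_mem_Pe (he : e ∈ H.edgeSet) (hi : i ∈ Pe e) (h : G.Adj i j) :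
    j ∈ Pe e ∨ i = ep e ∧ ∃ v ∈ e, j = bp v e := by
  rcases R.adj_cases i j h with ⟨u, hiu, hju⟩ | ⟨f, hf, hif, hjf⟩ | ⟨u, f, hf, hu, hif, -⟩ |
    ⟨u, f, hf, hu, ⟨rfl, rfl⟩ | ⟨rfl, rfl⟩⟩ | ⟨u, f, hf, hu, ⟨rfl, rfl⟩ | ⟨rfl, rfl⟩⟩ |
    ⟨a, b, hab, ⟨rfl, rfl⟩ | ⟨rfl, rfl⟩⟩
  · exact (R.notMem_Pe_of_mem_Pv hiu he hi).elim
  · exact Or.inl (R.eq_of_mem_Pe he hf hi hif ▸ hjf)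
  · exact (R.notMem_Pve_of_mem_Pe hi he hf hu hif).elim
  · exact (R.notMem_Pve_of_mem_Pe hi he hf hu (R.bp_mem hf hu)).elim
  · exact (R.notMem_Pe_of_mem_Pv (R.vp_mem u) he hi).elim
  · exact (R.notMem_Pve_of_mem_Pe hi he hf hu (R.bp_mem hf hu)).elim
  · obtain rfl := R.eq_of_mem_Pe he hf hi (R.ep_mem hf)
    exact Or.inr ⟨rfl, u, hu, rfl⟩
  · exact (R.notMem_Pve_of_mem_Pe hi he hab (Sym2.mem_mk_left a b)
      (R.bp_mem hab (Sym2.mem_mk_left a b))).elim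
  · exact (R.notMem_Pve_of_mem_Pe hi he hab (Sym2.mem_mk_right a b)
      (R.bp_mem hab (Sym2.mem_mk_right a b))).elim

lemma adj_of_mem_Pve {x y : V} (hxy : H.Adj x y) (hi : i ∈ Pve x s(x, y)) (h : G.Adj i j) :
    j ∈ Pve x s(x, y) ∨ i = bp x s(x, y) ∧
      (j = vp x ∨ j = ep s(x, y) ∨ j = bp y s(x, y)) := by
  have hx := Sym2.mem_mk_left x y
  have he : s(x, y) ∈ H.edgeSet := hxy
  rcases R.adj_cases i j h with ⟨u, hiu, hju⟩ | ⟨f, hf, hif, hjf⟩ | ⟨u, f, hf, hu, hif, hjf⟩ |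
    ⟨u, f, hf, hu, ⟨rfl, rfl⟩ | ⟨rfl, rfl⟩⟩ | ⟨u, f, hf, hu, ⟨rfl, rfl⟩ | ⟨rfl, rfl⟩⟩ |
    ⟨a, b, hab, h⟩
  · exact (R.notMem_Pve_of_mem_Pv hiu he hx hi).elim
  · exact (R.notMem_Pve_of_mem_Pe hif hf he hx hi).elim
  · obtain ⟨rfl, rfl⟩ := R.eq_of_mem_Pve he hx hf hu hi hif
    exact Or.inl hjf
  · obtain ⟨rfl, rfl⟩ := R.eq_of_mem_Pve he hx hf hu hi (R.bp_mem hf hu)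
    exact Or.inr ⟨rfl, Or.inl rfl⟩
  · exact (R.notMem_Pve_of_mem_Pv (R.vp_mem u) he hx hi).elim
  · obtain ⟨rfl, rfl⟩ := R.eq_of_mem_Pve he hx hf hu hi (R.bp_mem hf hu)
    exact Or.inr ⟨rfl, Or.inr (Or.inl rfl)⟩
  · exact (R.notMem_Pve_of_mem_Pe (R.ep_mem hf) hf he hx hi).elim
  · refine Or.inr ?_
    rcases h with ⟨rfl, rfl⟩ | ⟨rfl, rfl⟩
    · obtain ⟨rfl, hs⟩ := R.eq_of_mem_Pve he hx hab (Sym2.mem_mk_left a b) hi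
        (R.bp_mem hab (Sym2.mem_mk_left a b))
      obtain rfl := Sym2.congr_right.1 hs
      exact ⟨rfl, Or.inr (Or.inr rfl)⟩
    · obtain ⟨rfl, hs⟩ := R.eq_of_mem_Pve he hx hab (Sym2.mem_mk_right a b) hi
        (R.bp_mem hab (Sym2.mem_mk_right a b))
      rw [Sym2.eq_swap (a := a)] at hs ⊢
      obtain rfl := Sym2.congr_right.1 hs
      exact ⟨rfl, Or.inr (Or.inr rfl)⟩

lemma closed_Pv (v : V) : ∀ i ∈ Pv v, i ≠ vp v → ∀ j, G.Adj i j → j ∈ Pv v :=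
  fun _ hi hne _ h => (R.adj_of_mem_Pv hi h).resolve_right fun h' => hne h'.1

lemma closed_Pe (he : e ∈ H.edgeSet) : ∀ i ∈ Pe e, i ≠ ep e → ∀ j, G.Adj i j → j ∈ Pe e :=
  fun _ hi hne _ h => (R.adj_of_mem_Pe he hi h).resolve_right fun h' => hne h'.1

lemma closed_Pve {x y : V} (hxy : H.Adj x y) :
    ∀ i ∈ Pve x s(x, y), i ≠ bp x s(x, y) → ∀ j, G.Adj i j → j ∈ Pve x s(x, y) :=
  fun _ hi hne _ h => (R.adj_of_mem_Pve hxy hi h).resolve_right fun h' => hne h'.1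

end AvgALReduction

variable [Fintype N]

lemma fval_eq (hi : i ∈ C) :
    fval G C i = ((Fintype.card N : ℤ) + 1) * (friendsIn G C i).card - (C.card - 1) := by
  have h := card_friends_add_enemies (G := G) hi
  unfold fval
  zify at h
  linarith

lemma sum_fval_friendsIn :
    ∑ c ∈ friendsIn G C i, fval G C c =
      ((Fintype.card N : ℤ) + 1) * friendDegSum G C i
        - (friendsIn G C i).card * ((C.card : ℤ) - 1) := by
  rw [sum_congr rfl fun c hc => fval_eq (mem_friendsIn.1 hc).1, sum_sub_distrib, ← mul_sum,
    friendDegSum]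
  simp
  ring

lemma fval_sub_fval_lt (hA : i ∈ A) (hC : i ∈ C) :
    fval G C i - fval G A i < (Fintype.card N : ℤ) ^ 2 := by
  have h1 := card_friends_add_enemies (G := G) hA
  have h2 := card_friends_add_enemies (G := G) hC
  have h3 := card_le_univ A
  have h4 := card_le_univ C
  unfold fval
  zify at h1 h2 h3 h4
  have h5 : (0 : ℤ) ≤ (friendsIn G A i).card := by positivity
  have h6 : (0 : ℤ) ≤ (C.filter fun j => ¬ G.Adj i j ∧ j ≠ i).card := by positivity
  have h7 : (0 : ℤ) ≤ (A.filter fun j => ¬ G.Adj i j ∧ j ≠ i).card := by positivity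
  have h8 : ((friendsIn G C i).card : ℤ) ≤ Fintype.card N - 1 := by linarith
  have h9 := mul_le_mul_of_nonneg_left h8 (show (0 : ℤ) ≤ Fintype.card N by positivity)
  have h10 := mul_nonneg (show (0 : ℤ) ≤ Fintype.card N by positivity) h5
  nlinarith

lemma utilAvgAL_eq (w : ℚ) :
    utilAvgAL G w C i = (fval G C i : ℚ) +
      w * ((∑ c ∈ friendsIn G C i, fval G C c : ℤ) / ((friendsIn G C i).card : ℚ)) := by
  unfold utilAvgAL
  split_ifs with h
  · push_cast; rfl
  · simp [not_nonempty_iff_eq_empty.1 h]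

/-- With a large weight, a player with a friend in `A` that prefers `C` to `A` has a friend in `C`,
and the average valuation of its friends does not decrease. -/
lemma average_le_of_util_lt {w : ℚ} (hw : (Fintype.card N : ℚ) ^ 4 ≤ w)
    (hA : i ∈ A) (hC : i ∈ C) (hF : 0 < (friendsIn G A i).card)
    (h : utilAvgAL G w A i < utilAvgAL G w C i) :
    0 < (friendsIn G C i).card ∧
      (((Fintype.card N : ℤ) + 1) * friendDegSum G A i - A.card * (friendsIn G A i).card)
          * (friendsIn G C i).card ≤
        (((Fintype.card N : ℤ) + 1) * friendDegSum G C i - C.card * (friendsIn G C i).card)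
          * (friendsIn G A i).card := by
  rw [utilAvgAL_eq, utilAvgAL_eq] at h
  have hd : ((fval G C i : ℚ)) - fval G A i < (Fintype.card N : ℚ) ^ 2 := by
    exact_mod_cast fval_sub_fval_lt hA hC
  have hAn : (friendsIn G A i).card ≤ Fintype.card N := card_le_univ _
  have hCn : (friendsIn G C i).card ≤ Fintype.card N := card_le_univ _
  have hSA := sum_fval_friendsIn (G := G) (C := A) (i := i)
  have hSC := sum_fval_friendsIn (G := G) (C := C) (i := i)
  have hDA := card_friendsIn_le_friendDegSum (G := G) hA
  have hAle := card_le_univ A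
  set SA := ∑ c ∈ friendsIn G A i, fval G A c
  set SC := ∑ c ∈ friendsIn G C i, fval G C c
  set a := (friendsIn G A i).card
  set c := (friendsIn G C i).card
  set n := Fintype.card N
  have hn : 1 ≤ n := by omega
  have key : ∀ b : ℕ, 0 < b → b ≤ n → ∀ T : ℤ, (SC : ℚ) / c = T / b → SA * b ≤ T * a := by
    intro b hb hbn T hT
    rw [hT] at h
    by_contra! hlt
    have ha0 : (0 : ℚ) < a := by exact_mod_cast hF
    have hb0 : (0 : ℚ) < b := by exact_mod_cast hb
    have h1 : (1 : ℚ) ≤ SA * b - T * a := by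
      have : (1 : ℤ) ≤ SA * b - T * a := by linarith
      exact_mod_cast this
    have h2 : (SA : ℚ) / a - T / b = (SA * b - T * a) / (a * b) := by
      field_simp
    have hn0 : (0 : ℚ) < n := by exact_mod_cast hn
    have h3 : (a : ℚ) * b ≤ n ^ 2 := by
      rw [sq]
      exact mul_le_mul (by exact_mod_cast hAn) (by exact_mod_cast hbn) hb0.le hn0.le
    have h4 : (1 : ℚ) / n ^ 2 ≤ SA / a - T / b := by
      rw [h2]
      exact div_le_div₀ (by linarith) h1 (by positivity) h3
    have h5 : (n : ℚ) ^ 2 ≤ w * (SA / a - T / b) := by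
      calc (n : ℚ) ^ 2 = n ^ 4 * (1 / n ^ 2) := by field_simp
        _ ≤ w * (SA / a - T / b) := by
          apply mul_le_mul hw h4 (by positivity)
          exact le_trans (by positivity) hw
    linarith
  have hc : 0 < c := by
    by_contra hc
    have hc0 : c = 0 := by omega
    have := key 1 one_pos hn 0 (by simp [hc0])
    rw [hSA] at this
    zify at hDA hAle hF
    push_cast at this
    nlinarith
  refine ⟨hc, ?_⟩
  have := key c hc hCn SC rfl
  rw [hSA, hSC] at this
  linarith

lemma friendDegSum_le_of_util_lt {w : ℚ} (hw : (Fintype.card N : ℚ) ^ 4 ≤ w)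
    (hA : i ∈ A) (hC : i ∈ C) (hF : 0 < (friendsIn G A i).card)
    (h : utilAvgAL G w A i < utilAvgAL G w C i) {M : ℕ}
    (hM : ∀ c ∈ friendsIn G C i, (friendsIn G C c).card ≤ M) :
    ((Fintype.card N : ℤ) + 1) * friendDegSum G A i ≤
      (Fintype.card N * M + A.card - 1) * (friendsIn G A i).card := by
  obtain ⟨hc, hle⟩ := average_le_of_util_lt hw hA hC hF h
  have hval : ∑ c ∈ friendsIn G C i, fval G C c ≤
      (friendsIn G C i).card • ((Fintype.card N : ℤ) * M) := by
    refine sum_le_card_nsmul _ _ _ fun c hc => ?_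
    have : ((friendsIn G C c).card : ℤ) ≤ M := by exact_mod_cast hM c hc
    have h2 := mul_le_mul_of_nonneg_left this (show (0 : ℤ) ≤ Fintype.card N by positivity)
    unfold fval
    linarith [show (0 : ℤ) ≤ (C.filter fun j => ¬ G.Adj c j ∧ j ≠ c).card by positivity]
  rw [sum_fval_friendsIn, nsmul_eq_mul] at hval
  have hc' : (0 : ℤ) < (friendsIn G C i).card := by exact_mod_cast hc
  have hF' : (0 : ℤ) < (friendsIn G A i).card := by exact_mod_cast hF
  refine le_of_mul_le_mul_right (a := ((friendsIn G C i).card : ℤ)) ?_ hc'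
  have := mul_le_mul_of_nonneg_right hval hF'.le
  linarith

namespace IsPinchedDomeGadget

variable (hP : IsPinchedDomeGadget G d K P top mid fringe)
  (hcl : ∀ i ∈ P, i ≠ top → ∀ j, G.Adj i j → j ∈ P)
  {w : ℚ} (hw : (Fintype.card N : ℚ) ^ 4 ≤ w)
  (hC : ∀ i ∈ C, i ∈ P → utilAvgAL G w P i < utilAvgAL G w C i)
include hP hcl hw hC

lemma not_base_union_mid_subset (hd : 0 < d) (hbase : pdomeBase P top mid ⊆ C)
    (hmid : mid ∈ C) : False := by
  have hf : fringe ⟨0, hd⟩ ∈ univ.image fringe := mem_image_of_mem _ (mem_univ _)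
  set p := fringe ⟨0, hd⟩
  have hpB := hP.image_fringe_subset hf
  have hpP : p ∈ P := hP.mem_iff.2 (Or.inr (Or.inr hpB))
  have hpt : p ≠ top := fun h => top_notMem_pdomeBase (h ▸ hpB)
  have hfr := hP.friendsIn_fringe hf
  have hcard := hP.card_friendsIn_fringe hf
  have hBpos := card_pos.2 ⟨p, hpB⟩
  have hP2 := hP.card_base_add_two
  have hPn := card_le_univ P
  have hCP : friendsIn G C p = friendsIn G P p := by
    refine (friendsIn_subset_of_closed hcl hpP hpt).antisymm fun j hj => ?_
    have hadj := (mem_friendsIn.1 hj).2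
    rw [hfr, mem_insert] at hj
    rcases hj with rfl | hj
    · exact mem_friendsIn.2 ⟨hmid, hadj⟩
    · exact mem_friendsIn.2 ⟨hbase (mem_of_mem_erase hj), hadj⟩
  have hmem : ∀ c ∈ friendsIn G P p, c ∈ P ∧ c ≠ top := by
    intro c hc
    refine ⟨(mem_friendsIn.1 hc).1, ?_⟩
    rintro rfl
    rw [hfr, mem_insert] at hc
    rcases hc with h | h
    · exact hP.mid_ne_top h.symm
    · exact top_notMem_pdomeBase (mem_of_mem_erase h)
  have hlt := hC p (hbase hpB) hpP
  obtain ⟨-, hle⟩ := average_le_of_util_lt hw hpP (hbase hpB) (by omega) hlt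
  rw [hCP, hcard] at hle
  have hle := le_of_mul_le_mul_right hle (by exact_mod_cast hBpos)
  by_cases htop : top ∈ C
  · have hPC : P ⊆ C := by
      intro j hj
      rcases hP.mem_iff.1 hj with rfl | rfl | hj
      exacts [htop, hmid, hbase hj]
    have hD : friendDegSum G C p = friendDegSum G P p := by
      rw [friendDegSum, friendDegSum, hCP]
      refine sum_congr rfl fun c hc => ?_
      rw [friendsIn_eq_of_subset hPC (hcl c (hmem c hc).1 (hmem c hc).2)]
    rw [hD] at hle
    have h2 : (C.card : ℤ) * (pdomeBase P top mid).card ≤ P.card * (pdomeBase P top mid).card := by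
      linarith
    have h3 : C.card ≤ P.card := by
      exact_mod_cast le_of_mul_le_mul_right h2 (by exact_mod_cast hBpos)
    rw [eq_of_subset_of_card_le hPC h3] at hlt
    exact lt_irrefl _ hlt
  · have hD : friendDegSum G C p < friendDegSum G P p := by
      rw [friendDegSum, friendDegSum, hCP]
      refine sum_lt_sum (fun c hc => card_le_card
        (friendsIn_subset_of_closed hcl (hmem c hc).1 (hmem c hc).2)) ⟨mid, ?_, ?_⟩
      · rw [hfr]
        exact mem_insert_self _ _
      · apply card_lt_card
        refine ⟨friendsIn_subset_of_closed hcl hP.mid_mem hP.mid_ne_top, fun h => htop ?_⟩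
        refine (mem_friendsIn.1 (h ?_)).1
        rw [hP.friendsIn_mid]
        exact mem_insert_self _ _
    have hCcard : P.card ≤ C.card + 1 := by
      have h : insert mid (pdomeBase P top mid) ⊆ C := insert_subset hmid hbase
      have := card_le_card h
      rw [card_insert_of_notMem mid_notMem_pdomeBase] at this
      omega
    zify at hD hCcard hP2 hPn hBpos
    nlinarith

lemma base_subset_fringe_of_mem (hd : 2 ≤ d) (hi : i ∈ C) (hiB : i ∈ pdomeBase P top mid) :
    i ∈ univ.image fringe := by
  by_contra hf
  have hiP : i ∈ P := hP.mem_iff.2 (Or.inr (Or.inr hiB))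
  have hit : i ≠ top := fun h => top_notMem_pdomeBase (h ▸ hiB)
  have hcard := hP.card_friendsIn_base_of_notMem_fringe hiB hf
  have hlt : d < (pdomeBase P top mid).card := by
    rw [← hP.card_image_fringe]
    exact card_lt_card ⟨hP.image_fringe_subset, fun h => hf (h hiB)⟩
  have hP2 := hP.card_base_add_two
  have hPn := card_le_univ P
  have hsub : friendsIn G C i ⊆ friendsIn G P i := friendsIn_subset_of_closed hcl hiP hit
  by_cases hM : ∀ c ∈ friendsIn G C i, (friendsIn G C c).card ≤ (pdomeBase P top mid).card - 1
  · have hle := friendDegSum_le_of_util_lt hw hiP hi (by omega) (hC i hi hiP) hM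
    rw [hP.friendDegSum_base_of_notMem_fringe hiB hf, hcard] at hle
    obtain ⟨b, hb⟩ : ∃ b, (pdomeBase P top mid).card = b + 1 := ⟨_, (Nat.sub_add_cancel
      (by omega)).symm⟩
    rw [hb] at hle hP2
    rw [Nat.add_sub_cancel] at hle
    push_cast at hle
    zify at hP2 hPn hd
    have := mul_le_mul_of_nonneg_left hd (show (0 : ℤ) ≤ Fintype.card N + 1 by positivity)
    rw [← hP2] at hle hPn
    nlinarith
  · push Not at hM
    obtain ⟨c, hc, hM⟩ := hM
    have hcB : c ∈ pdomeBase P top mid := by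
      have := hsub hc
      rw [hP.friendsIn_base_of_notMem_fringe hiB hf] at this
      exact mem_of_mem_erase this
    have hcP : c ∈ P := hP.mem_iff.2 (Or.inr (Or.inr hcB))
    have hct : c ≠ top := fun h => top_notMem_pdomeBase (h ▸ hcB)
    have hsubc : friendsIn G C c ⊆ friendsIn G P c := friendsIn_subset_of_closed hcl hcP hct
    have hcf : c ∈ univ.image fringe := by
      by_contra hcf
      have := card_le_card hsubc
      rw [hP.card_friendsIn_base_of_notMem_fringe hcB hcf] at this
      omega
    have heq := eq_of_subset_of_card_le hsubc (by rw [hP.card_friendsIn_fringe hcf]; omega)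
    rw [hP.friendsIn_fringe hcf] at heq
    refine hP.not_base_union_mid_subset hcl hw hC (by omega) (fun j hj => ?_) ?_
    · by_cases hjc : j = c
      · exact hjc ▸ (mem_friendsIn.1 hc).1
      · have : j ∈ friendsIn G C c := by
          rw [heq]
          exact mem_insert_of_mem (mem_erase.2 ⟨hjc, hj⟩)
        exact (mem_friendsIn.1 this).1
    · have : mid ∈ friendsIn G C c := by
        rw [heq]
        exact mem_insert_self _ _
      exact (mem_friendsIn.1 this).1

/-- A coalition preferred by all its members in the gadget contains no base player. -/
lemma disjoint_base (hd : 2 ≤ d) (hB : d + 4 ≤ (pdomeBase P top mid).card) :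
    Disjoint C (pdomeBase P top mid) := by
  rw [disjoint_left]
  intro i hi hiB
  have hfr : ∀ j ∈ C, j ∈ pdomeBase P top mid → j ∈ univ.image fringe :=
    fun j => hP.base_subset_fringe_of_mem hcl hw hC hd
  have hf := hfr i hi hiB
  have hiP : i ∈ P := hP.mem_iff.2 (Or.inr (Or.inr hiB))
  have hit : i ≠ top := fun h => top_notMem_pdomeBase (h ▸ hiB)
  have hP2 := hP.card_base_add_two
  have hPn := card_le_univ P
  have hM : ∀ c ∈ friendsIn G C i, (friendsIn G C c).card ≤ d + 1 := by
    intro c hc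
    have hcC := (mem_friendsIn.1 hc).1
    have hc' := friendsIn_subset_of_closed hcl hiP hit hc
    rw [hP.friendsIn_fringe hf, mem_insert] at hc'
    rcases hc' with rfl | hcB
    · rw [← hP.card_friendsIn_mid]
      exact card_le_card (friendsIn_subset_of_closed hcl hP.mid_mem hP.mid_ne_top)
    · replace hcB := mem_of_mem_erase hcB
      have hcP : c ∈ P := hP.mem_iff.2 (Or.inr (Or.inr hcB))
      have hct : c ≠ top := fun h => top_notMem_pdomeBase (h ▸ hcB)
      refine (card_le_card (t := insert mid (univ.image fringe)) fun j hj => ?_).trans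
        ((card_insert_le _ _).trans (by rw [hP.card_image_fringe]))
      have hjC := (mem_friendsIn.1 hj).1
      have := friendsIn_subset_of_closed hcl hcP hct hj
      rw [hP.friendsIn_fringe (hfr c hcC hcB), mem_insert] at this
      rw [mem_insert]
      exact this.imp_right fun h => hfr j hjC (mem_of_mem_erase h)
  have hcard := hP.card_friendsIn_fringe hf
  have hle := friendDegSum_le_of_util_lt hw hiP hi (by omega) (hC i hi hiP) hM
  have hge := hP.le_friendDegSum_fringe hf
  rw [hcard] at hle
  obtain ⟨b, hb⟩ : ∃ b, (pdomeBase P top mid).card = d + 4 + b := ⟨_, (Nat.add_sub_of_le hB).symm⟩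
  rw [hb] at hle hge hP2
  rw [show d + 4 + b - 1 = d + 3 + b by omega] at hge
  obtain ⟨m, hm⟩ : ∃ m, Fintype.card N = P.card + m := ⟨_, (Nat.add_sub_of_le hPn).symm⟩
  rw [hm, ← hP2] at hle
  zify at hge
  push_cast at hle
  have := mul_le_mul_of_nonneg_left hge (show (0 : ℤ) ≤ d + 4 + b + 2 + m + 1 by positivity)
  nlinarith [show (0 : ℤ) ≤ (d : ℤ) * b by positivity, show (0 : ℤ) ≤ (d : ℤ) * m by positivity,
    show (0 : ℤ) ≤ (b : ℤ) * m by positivity, show (0 : ℤ) ≤ (d : ℤ) * b * m by positivity,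
    show (0 : ℤ) ≤ (b : ℤ) * b * m by positivity, show (0 : ℤ) ≤ (b : ℤ) * b by positivity,
    show (0 : ℤ) ≤ (b : ℤ) * b * b by positivity, show (0 : ℤ) ≤ (d : ℤ) * b * b by positivity,
    show (0 : ℤ) ≤ (d : ℤ) * d * b by positivity, show (0 : ℤ) ≤ (d : ℤ) * d by positivity]

lemma card_friendsIn_mid_le_one (hd : 2 ≤ d) (hB : d + 4 ≤ (pdomeBase P top mid).card) :
    (friendsIn G C mid).card ≤ 1 := by
  rw [← card_singleton top]
  refine card_le_card fun j hj => ?_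
  have hj' := friendsIn_subset_of_closed hcl hP.mid_mem hP.mid_ne_top hj
  rw [hP.friendsIn_mid, mem_insert] at hj'
  rcases hj' with rfl | hj'
  · exact mem_singleton_self _
  · exact (disjoint_left.1 (hP.disjoint_base hcl hw hC hd hB) (mem_friendsIn.1 hj).1
      (hP.image_fringe_subset hj')).elim

lemma mid_notMem (hd : 2 ≤ d) (hB : d + 12 ≤ (pdomeBase P top mid).card)
    (htop : (friendsIn G C top).card ≤ 4) : mid ∉ C := by
  intro hmid
  have hdisj := hP.disjoint_base hcl hw hC hd (by omega)
  have hP2 := hP.card_base_add_two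
  have hPn := card_le_univ P
  have hM : ∀ c ∈ friendsIn G C mid, (friendsIn G C c).card ≤ 4 := by
    intro c hc
    have hc' := friendsIn_subset_of_closed hcl hP.mid_mem hP.mid_ne_top hc
    rw [hP.friendsIn_mid, mem_insert] at hc'
    rcases hc' with rfl | hc'
    · exact htop
    · exact (disjoint_left.1 hdisj (mem_friendsIn.1 hc).1 (hP.image_fringe_subset hc')).elim
  have hcard := hP.card_friendsIn_mid
  have hle := friendDegSum_le_of_util_lt hw hP.mid_mem hmid (by omega) (hC mid hmid hP.mid_mem) hM
  have hge := hP.mul_card_base_le_friendDegSum_mid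
  rw [hcard] at hle
  obtain ⟨b, hb⟩ : ∃ b, (pdomeBase P top mid).card = d + 12 + b :=
    ⟨_, (Nat.add_sub_of_le hB).symm⟩
  rw [hb] at hge hP2
  obtain ⟨m, hm⟩ : ∃ m, Fintype.card N = P.card + m := ⟨_, (Nat.add_sub_of_le hPn).symm⟩
  obtain ⟨e, rfl⟩ : ∃ e, d = 2 + e := ⟨_, (Nat.add_sub_of_le hd).symm⟩
  rw [hm, ← hP2] at hle
  zify at hge
  push_cast at hle hge
  have := mul_le_mul_of_nonneg_left hge (show (0 : ℤ) ≤ 2 + e + 12 + b + 2 + m + 1 by positivity)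
  nlinarith [show (0 : ℤ) ≤ (e : ℤ) * b by positivity, show (0 : ℤ) ≤ (e : ℤ) * m by positivity,
    show (0 : ℤ) ≤ (b : ℤ) * m by positivity, show (0 : ℤ) ≤ (e : ℤ) * b * m by positivity,
    show (0 : ℤ) ≤ (b : ℤ) * b * e by positivity, show (0 : ℤ) ≤ (b : ℤ) * b by positivity,
    show (0 : ℤ) ≤ (e : ℤ) * e * m by positivity, show (0 : ℤ) ≤ (e : ℤ) * e * e by positivity,
    show (0 : ℤ) ≤ (e : ℤ) * e * b by positivity, show (0 : ℤ) ≤ (e : ℤ) * e by positivity]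

lemma friendsIn_top_subset (hd : 2 ≤ d) (hB : d + 12 ≤ (pdomeBase P top mid).card)
    {S : Finset N} (hS : ∀ j, G.Adj top j → j ∈ P ∨ j ∈ S) (hcard : S.card ≤ 3) :
    friendsIn G C top ⊆ S := by
  have h : friendsIn G C top ⊆ insert mid S := by
    intro j hj
    have hadj := (mem_friendsIn.1 hj).2
    rw [mem_insert]
    refine (hS j hadj).imp_left fun hjP => ?_
    rw [← mem_singleton, ← hP.friendsIn_top]
    exact mem_friendsIn.2 ⟨hjP, hadj⟩
  have h4 := (card_le_card h).trans (card_insert_le _ _)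
  have hmid := hP.mid_notMem hcl hw hC hd hB (by omega)
  intro j hj
  refine mem_of_mem_insert_of_ne (h hj) ?_
  rintro rfl
  exact hmid (mem_friendsIn.1 hj).1

end IsPinchedDomeGadget

namespace AvgALReduction

variable {V : Type*} {H : SimpleGraph V} {k : ℕ}
  {Pv : V → Finset N} {Pe : Sym2 V → Finset N} {Pve : V → Sym2 V → Finset N}
  {vp : V → N} {ep : Sym2 V → N} {bp : V → Sym2 V → N}
  (R : AvgALReduction H k G Pv Pe Pve vp ep bp)
include R

/-- The gadgets of a vertex and of its incident edges are disjoint. -/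
lemma mul_card_incident_le (x : V) {I : Finset (Sym2 V)}
    (hI : ∀ e ∈ I, e ∈ H.edgeSet) :
    (I.card + 1) * (avgK' k - 1) ≤ Fintype.card N := by
  have hK : 2 < avgK' k ∨ avgK' k ≤ 2 := lt_or_ge _ _
  have hcard : ∀ P top, HasPinchedDomeGadget G 2 (avgK' k) P top → avgK' k - 1 ≤ P.card := by
    rintro P top ⟨mid, fringe, h⟩
    rw [h.card_eq]
    omega
  have hd : (I : Set (Sym2 V)).PairwiseDisjoint Pe := fun e he f hf hne =>
    R.disj_ee e (hI e he) f (hI f hf) hne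
  have h2 : Disjoint (Pv x) (I.biUnion Pe) :=
    (disjoint_biUnion_right _ _ _).2 fun e he => R.disj_v_e x e (hI e he)
  have h3 := card_le_univ (Pv x ∪ I.biUnion Pe)
  rw [card_union_of_disjoint h2, card_biUnion hd] at h3
  have h4 := card_nsmul_le_sum I (fun e => (Pe e).card) (avgK' k - 1)
    fun e he => hcard _ _ (R.pdome_e e (hI e he))
  have h5 := hcard _ _ (R.pdome_v x)
  rw [smul_eq_mul] at h4
  linarith

variable {w : ℚ} (hw : (Fintype.card N : ℚ) ^ 4 ≤ w) (hk : 5 ≤ k) {x y : V} (hxy : H.Adj x y)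
include hw hk hxy

lemma friendsIn_bp_subset
    (hC : ∀ i ∈ C, i ∈ Pve x s(x, y) → utilAvgAL G w (Pve x s(x, y)) i < utilAvgAL G w C i) :
    friendsIn G C (bp x s(x, y)) ⊆ {vp x, ep s(x, y), bp y s(x, y)} := by
  obtain ⟨mid, fringe, h⟩ := R.pdome_ve x s(x, y) hxy (Sym2.mem_mk_left x y)
  have hK := seven_mul_add_one_le_avgK' hk
  have hcard := h.card_eq
  have hB := h.card_base_add_two
  refine h.friendsIn_top_subset (R.closed_Pve hxy) hw hC (by omega) (by omega) (fun j hj => ?_)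
    card_le_three
  refine (R.adj_of_mem_Pve hxy h.top_mem hj).imp_right fun h' => ?_
  simpa using h'.2

lemma friendsIn_ep_subset
    (hC : ∀ i ∈ C, i ∈ Pe s(x, y) → utilAvgAL G w (Pe s(x, y)) i < utilAvgAL G w C i) :
    friendsIn G C (ep s(x, y)) ⊆ {bp x s(x, y), bp y s(x, y)} := by
  obtain ⟨mid, fringe, h⟩ := R.pdome_e s(x, y) hxy
  have hK := seven_mul_add_one_le_avgK' hk
  have hcard := h.card_eq
  have hB := h.card_base_add_two
  refine h.friendsIn_top_subset (R.closed_Pe hxy) hw hC le_rfl (by omega) (fun j hj => ?_)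
    (card_le_two.trans (by norm_num))
  refine (R.adj_of_mem_Pe hxy h.top_mem hj).imp_right ?_
  rintro ⟨-, v, hv, rfl⟩
  rcases Sym2.mem_iff.1 hv with rfl | rfl <;> simp

end AvgALReduction

end AvgAL

/-- In the avg-AL reduction instance, if a coalition `C` blocks `Γ` and a vertex
player `vp x` belongs to `C`, then every friend of `vp x` in `C` has exactly three
friends in `C`, and at least `k − 1` edges of `H` incident to `x` have their edge
player in `C`. -/
theorem avgAL_vertex_player_degree {V N : Type*} [Fintype V] [DecidableEq V]
    [Fintype N] [DecidableEq N]
    (H : SimpleGraph V) (k : ℕ) (hk : 3 ≤ k)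
    (hsize : k < Fintype.card V + H.edgeFinset.card) (hdvd : 3 ∣ (k + 1))
    (G : SimpleGraph N) (Pv : V → Finset N) (Pe : Sym2 V → Finset N)
    (Pve : V → Sym2 V → Finset N)
    (vp : V → N) (ep : Sym2 V → N) (bp : V → Sym2 V → N)
    (R : AvgALReduction H k G Pv Pe Pve vp ep bp)
    (w : ℚ) (hw : (Fintype.card N : ℚ) ^ 4 ≤ w)
    (Γ : CoalitionStructure N) (hΓ : IsAvgGamma H Pv Pe Pve Γ)
    (C : Finset N) (hC : Blocks (utilAvgAL G w) Γ C)
    (x : V) (hx : vp x ∈ C) :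
    (∀ j ∈ C, G.Adj (vp x) j → (friendsIn G C j).card = 3) ∧
      k - 1 ≤ (H.edgeFinset.filter (fun e => x ∈ e ∧ ep e ∈ C)).card := by
  have hk5 : 5 ≤ k := by omega
  have hK := seven_mul_add_one_le_avgK' hk5
  have hCv : ∀ v, ∀ i ∈ C, i ∈ Pv v → utilAvgAL G w (Pv v) i < utilAvgAL G w C i :=
    fun v i hi hP => hΓ.1 v i hP ▸ hC.2 i hi
  have hCe : ∀ e ∈ H.edgeSet, ∀ i ∈ C, i ∈ Pe e → utilAvgAL G w (Pe e) i < utilAvgAL G w C i :=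
    fun e he i hi hP => hΓ.2.1 e he i hP ▸ hC.2 i hi
  have hCve : ∀ (v : V), ∀ e ∈ H.edgeSet, v ∈ e → ∀ i ∈ C, i ∈ Pve v e →
      utilAvgAL G w (Pve v e) i < utilAvgAL G w C i :=
    fun v e he hv i hi hP => hΓ.2.2 v e he hv i hP ▸ hC.2 i hi
  have hbp : ∀ v y, H.Adj v y →
      friendsIn G C (bp v s(v, y)) ⊆ {vp v, ep s(v, y), bp y s(v, y)} := fun v y hvy =>
    R.friendsIn_bp_subset hw hk5 hvy (hCve v s(v, y) hvy (Sym2.mem_mk_left v y))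
  obtain ⟨mid, fringe, hg⟩ := R.pdome_v x
  have hcard := hg.card_eq
  have hB := hg.card_base_add_two
  have hmid1 := hg.card_friendsIn_mid_le_one (R.closed_Pv x) hw (hCv x) le_rfl (by omega)
  have hadj : ∀ j, G.Adj (vp x) j → j = mid ∨ ∃ y, H.Adj x y ∧ j = bp x s(x, y) := by
    intro j hj
    refine (R.adj_of_mem_Pv (R.vp_mem x) hj).imp (fun hjP => ?_) ?_
    · rw [← mem_singleton, ← hg.friendsIn_top]
      exact mem_friendsIn.2 ⟨hjP, hj⟩
    · rintro ⟨-, e, he, hxe, rfl⟩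
      obtain ⟨y, rfl⟩ := hxe
      exact ⟨y, he, rfl⟩
  have hle3 : ∀ j ∈ friendsIn G C (vp x), (friendsIn G C j).card ≤ 3 := by
    intro j hj
    rcases hadj j (mem_friendsIn.1 hj).2 with rfl | ⟨y, hxy, rfl⟩
    · omega
    · exact (card_le_card (hbp x y hxy)).trans card_le_three
  obtain ⟨hF, hle⟩ := average_le_of_util_lt hw (R.vp_mem x) hx (by rw [hg.friendsIn_top]; simp)
    (hCv x (vp x) hx (R.vp_mem x))
  rw [hg.friendDegSum_top, hg.friendsIn_top, card_singleton, hcard] at hle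
  have hFI : (friendsIn G C (vp x)).card ≤ (H.edgeFinset.filter (x ∈ ·)).card + 1 := by
    refine (card_le_card (t := insert mid ((H.edgeFinset.filter (x ∈ ·)).image (bp x)))
      fun j hj => ?_).trans ((card_insert_le _ _).trans (Nat.add_le_add_right card_image_le 1))
    rw [mem_insert, mem_image]
    refine (hadj j (mem_friendsIn.1 hj).2).imp_right ?_
    rintro ⟨y, hxy, rfl⟩
    exact ⟨s(x, y), by simpa using hxy, rfl⟩
  have hnI := R.mul_card_incident_le x (I := H.edgeFinset.filter (x ∈ ·)) fun e he =>
    SimpleGraph.mem_edgeFinset.1 (mem_filter.1 he).1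
  have hDge : 3 * (friendsIn G C (vp x)).card ≤ friendDegSum G C (vp x) := by
    by_contra! hD
    have h1 := (Nat.mul_le_mul_right (avgK' k - 1) hFI).trans hnI
    obtain ⟨K, hKe⟩ : ∃ K, avgK' k = K + 1 := ⟨_, (Nat.sub_add_cancel (by omega)).symm⟩
    rw [hKe, show K + 1 - 2 + 1 = K by omega] at hle
    rw [hKe, Nat.add_sub_cancel] at h1
    push_cast at hle
    zify at hD h1
    have h2 := mul_le_mul_of_nonneg_left (Int.add_one_le_of_lt hD)
      (show (0 : ℤ) ≤ Fintype.card N + 1 by positivity)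
    nlinarith [show (0 : ℤ) ≤ C.card * (friendsIn G C (vp x)).card by positivity]
  have hdeg : ∀ j ∈ friendsIn G C (vp x), (friendsIn G C j).card = 3 := by
    refine (sum_eq_sum_iff_of_le hle3).1 (le_antisymm (sum_le_sum hle3) ?_)
    rw [sum_const, smul_eq_mul, mul_comm]
    exact hDge
  have hfriend : ∀ j ∈ friendsIn G C (vp x), ∃ y, H.Adj x y ∧ j = bp x s(x, y) ∧
      friendsIn G C j = {vp x, ep s(x, y), bp y s(x, y)} := by
    intro j hj
    have h3 := hdeg j hj
    rcases hadj j (mem_friendsIn.1 hj).2 with rfl | ⟨y, hxy, rfl⟩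
    · omega
    · exact ⟨y, hxy, rfl, eq_of_subset_of_card_le (hbp x y hxy) (by rw [h3]; exact card_le_three)⟩
  refine ⟨fun j hj h => hdeg j (mem_friendsIn.2 ⟨hj, h⟩), ?_⟩
  have hFle : (friendsIn G C (vp x)).card ≤
      (H.edgeFinset.filter (fun e => x ∈ e ∧ ep e ∈ C)).card := by
    refine (card_le_card fun j hj => ?_).trans (card_image_le (f := bp x))
    obtain ⟨y, hxy, rfl, heq⟩ := hfriend j hj
    have hep : ep s(x, y) ∈ friendsIn G C (bp x s(x, y)) := by simp [heq]
    refine mem_image_of_mem _ (mem_filter.2 ⟨SimpleGraph.mem_edgeFinset.2 hxy, ?_, ?_⟩)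
    exacts [Sym2.mem_mk_left x y, (mem_friendsIn.1 hep).1]
  refine le_trans ?_ hFle
  have hFI' : (friendsIn G C (vp x)).card ≤ (H.edgeFinset.filter (x ∈ ·)).card :=
    hFle.trans (card_le_card fun e he => by
      rw [mem_filter] at he ⊢
      exact ⟨he.1, he.2.1⟩)
  obtain ⟨j, hj⟩ := card_pos.1 hF
  have hj3 := hdeg j hj
  have hjC := (mem_friendsIn.1 hj).1
  obtain ⟨y, hxy, rfl, heq⟩ := hfriend j hj
  have hxe := Sym2.mem_mk_left x y
  obtain ⟨midb, fringeb, hgb⟩ := R.pdome_ve x s(x, y) hxy hxe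
  obtain ⟨-, hleb⟩ := average_le_of_util_lt hw hgb.top_mem hjC (by rw [hgb.friendsIn_top]; simp)
    (hCve x s(x, y) hxy hxe _ hjC hgb.top_mem)
  have hD : friendDegSum G C (bp x s(x, y)) ≤ (friendsIn G C (vp x)).card + 5 := by
    have he2 := (card_le_card (R.friendsIn_ep_subset hw hk5 hxy (hCe s(x, y) hxy))).trans
      card_le_two
    have hb3 := hbp y x hxy.symm
    rw [Sym2.eq_swap] at hb3
    replace hb3 := (card_le_card hb3).trans card_le_three
    rw [heq] at hj3
    have h1 : vp x ∉ ({ep s(x, y), bp y s(x, y)} : Finset N) := by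
      intro h
      rw [insert_eq_of_mem h] at hj3
      have := card_le_two (a := ep s(x, y)) (b := bp y s(x, y))
      omega
    have h2 : ep s(x, y) ≠ bp y s(x, y) := by
      intro h
      rw [h, pair_eq_singleton] at hj3
      have := card_le_two (a := vp x) (b := bp y s(x, y))
      omega
    rw [friendDegSum, heq, sum_insert h1, sum_pair h2]
    omega
  rw [hgb.friendDegSum_top, hgb.friendsIn_top, card_singleton, hgb.card_eq, hj3] at hleb
  have hn := (Nat.mul_le_mul_right (avgK' k - 1) (Nat.add_le_add_right hFI' 1)).trans hnI
  obtain ⟨d, hd⟩ := hdvd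
  obtain ⟨K, hKe⟩ : ∃ K, avgK' k = d + K := ⟨_, (Nat.add_sub_of_le (by omega)).symm⟩
  rw [hKe] at hn hleb hK
  rw [show (k + 1) / 3 = d by omega, show d + K - d + 1 = K + 1 by omega] at hleb
  set F := (friendsIn G C (vp x)).card
  have hK1 : K + 1 ≤ d + K - 1 := by omega
  have hn1 : (F + 1) * (K + 1) ≤ Fintype.card N := (Nat.mul_le_mul_left _ hK1).trans hn
  have hgoal : (k : ℤ) - 1 ≤ F := by
    zify at hD hn1 hF hd hk5
    push_cast at hleb
    have h1 := mul_le_mul_of_nonneg_left hD (show (0 : ℤ) ≤ Fintype.card N + 1 by positivity)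
    refine sub_one_le_of_mul_le (K := K) (by positivity) hk5 hF hn1 ?_
    rw [show (k : ℤ) = 3 * d - 1 by linarith]
    linarith [show (0 : ℤ) ≤ C.card by positivity]
  omega
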